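/- arXiv:1507.06640 — 4 statements merged into one kernel-verified Lean document; each statement's English description precedes it below -/
import Mathlib

section
/- Let n ≥ 2 be a natural number. For positive reals u₁, …, u_{n-1}, define arctanₙ(u₁,…,u_{n-1}) = ∫₀^{u₁} ⋯ ∫₀^{u_{n-1}} 1/(1 + x₁ⁿ + ⋯ + x_{n-1}ⁿ) dx₁⋯dx_{n-1}. Then for every real u > 0, arctanₙ(u, u, …, u) + (n-1) · arctanₙ(1/u, 1, …, 1) = n · ((1/n) · Γ(1/n))ⁿ. -/
open MeasureTheory

/-- The `n`-th order arctan: the Lebesgue integral of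
`x ↦ 1/(1 + x₁ⁿ + ⋯ + x_{n-1}ⁿ)` over the box `[0,u₁] × ⋯ × [0,u_{n-1}]`. -/
noncomputable def arctanN (n : ℕ) (u : Fin (n - 1) → ℝ) : ℝ :=
  ∫ x in Set.univ.pi (fun i => Set.Icc (0:ℝ) (u i)),
    1 / (1 + ∑ i, x i ^ n)

open Set Filter Topology

/-- The incomplete integral `∫₀ˢ exp(-xⁿ) dx`. -/
noncomputable def expNegPowIntegral (n : ℕ) (s : ℝ) : ℝ :=
  ∫ x in (0:ℝ)..s, Real.exp (-x ^ n)

lemma continuous_exp_neg_pow (n : ℕ) : Continuous fun x : ℝ => Real.exp (-x ^ n) := by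
  fun_prop

lemma hasDerivAt_expNegPowIntegral (n : ℕ) (s : ℝ) :
    HasDerivAt (expNegPowIntegral n) (Real.exp (-s ^ n)) s :=
  (continuous_exp_neg_pow n).integral_hasStrictDerivAt 0 s |>.hasDerivAt

lemma expNegPowIntegral_zero (n : ℕ) : expNegPowIntegral n 0 = 0 := by
  simp [expNegPowIntegral]

lemma expNegPowIntegral_nonneg (n : ℕ) {s : ℝ} (hs : 0 ≤ s) : 0 ≤ expNegPowIntegral n s :=
  intervalIntegral.integral_nonneg hs fun _ _ => (Real.exp_pos _).le

lemma integrableOn_pow_mul_exp_neg_pow {n : ℕ} (hn : n ≠ 0) (m : ℕ) :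
    IntegrableOn (fun x : ℝ => x ^ m * Real.exp (-x ^ n)) (Ioi 0) := by
  have h := integrableOn_rpow_mul_exp_neg_rpow (p := n) (s := m)
    (by linarith [m.cast_nonneg (α := ℝ)]) (by positivity)
  simpa only [Real.rpow_natCast] using h

lemma tendsto_expNegPowIntegral_atTop {n : ℕ} (hn : n ≠ 0) :
    Tendsto (expNegPowIntegral n) atTop (𝓝 ((1 / n) * Real.Gamma (1 / n))) := by
  have hn' : (0:ℝ) < n := by positivity
  have hG : ∫ x in Ioi (0:ℝ), Real.exp (-x ^ n) = (1 / n) * Real.Gamma (1 / n) := by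
    have h := integral_exp_neg_rpow hn'
    simp only [Real.rpow_natCast] at h
    rw [h, Real.Gamma_add_one (by positivity)]
  rw [← hG]
  exact intervalIntegral_tendsto_integral_Ioi 0
    (by simpa using integrableOn_pow_mul_exp_neg_pow hn 0) tendsto_id

lemma integral_pow_mul_exp_neg_mul_pow (m : ℕ) {b : ℝ} (hb : 0 < b) :
    ∫ x in Ioi (0:ℝ), x ^ m * Real.exp (-(b * x ^ (m + 1))) = 1 / b / (m + 1) := by
  have h := integral_rpow_mul_exp_neg_mul_rpow (p := (m + 1 : ℕ)) (q := m) (by positivity)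
    (by linarith [m.cast_nonneg (α := ℝ)]) hb
  have hm : ((m : ℝ) + 1) ≠ 0 := by positivity
  simp only [Real.rpow_natCast, neg_mul] at h
  rw [h]
  push_cast
  rw [neg_div, div_self hm, Real.rpow_neg_one, Real.Gamma_one]
  field_simp

lemma expNegPowIntegral_mul (n : ℕ) {u : ℝ} (hu : 0 ≤ u) (t : ℝ) :
    expNegPowIntegral n (u * t) = t * ∫ x in Icc 0 u, Real.exp (-(t * x) ^ n) := by
  rw [integral_Icc_eq_integral_Ioc, ← intervalIntegral.integral_of_le hu,
    intervalIntegral.mul_integral_comp_mul_left (f := fun x => Real.exp (-x ^ n)), mul_zero,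
    mul_comm, expNegPowIntegral]

/-- Laplace representation of `arctanₙ` as a one-dimensional integral. -/
lemma arctanN_eq_integral {m : ℕ} (u : Fin m → ℝ) (hu : ∀ i, 0 ≤ u i) :
    arctanN (m + 1) u = (m + 1) *
      ∫ t in Ioi (0:ℝ), Real.exp (-t ^ (m + 1)) * ∏ i, expNegPowIntegral (m + 1) (u i * t) := by
  set B : Set (Fin m → ℝ) := univ.pi fun i => Icc 0 (u i)
  have hBm : MeasurableSet B := MeasurableSet.univ_pi fun _ => measurableSet_Icc
  have hBfin : IsFiniteMeasure (volume.restrict B) :=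
    isFiniteMeasure_restrict.2 (isCompact_univ_pi fun _ => isCompact_Icc).measure_lt_top.ne
  have hsum : ∀ x ∈ B, 0 ≤ ∑ i, x i ^ (m + 1) := fun x hx =>
    Finset.sum_nonneg fun i _ => pow_nonneg (hx i (mem_univ i)).1 _
  have hinner : ∀ x ∈ B, ∫ t in Ioi (0:ℝ),
      t ^ m * Real.exp (-((1 + ∑ i, x i ^ (m + 1)) * t ^ (m + 1)))
        = 1 / (1 + ∑ i, x i ^ (m + 1)) / (m + 1) := fun x hx =>
    integral_pow_mul_exp_neg_mul_pow m (by linarith [hsum x hx])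
  have hint : Integrable (Function.uncurry fun (t : ℝ) (x : Fin m → ℝ) =>
      t ^ m * Real.exp (-((1 + ∑ i, x i ^ (m + 1)) * t ^ (m + 1))))
      ((volume.restrict (Ioi 0)).prod (volume.restrict B)) := by
    refine ((integrableOn_pow_mul_exp_neg_pow m.succ_ne_zero m).integrable.comp_fst
      (volume.restrict B)).mono' ?_ ?_
    · exact Continuous.aestronglyMeasurable (by unfold Function.uncurry; fun_prop)
    · rw [Measure.prod_restrict]
      filter_upwards [ae_restrict_mem (measurableSet_Ioi.prod hBm)] with p hp
      have ht : (0:ℝ) < p.1 := hp.1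
      have hs := hsum p.2 hp.2
      rw [Function.uncurry, Real.norm_of_nonneg (by positivity)]
      gcongr
      exact le_mul_of_one_le_left (pow_pos ht (m + 1)).le (le_add_of_nonneg_right hs)
  have hprod : ∀ t ∈ Ioi (0:ℝ),
      Real.exp (-t ^ (m + 1)) * ∏ i, expNegPowIntegral (m + 1) (u i * t)
        = ∫ x in B, t ^ m * Real.exp (-((1 + ∑ i, x i ^ (m + 1)) * t ^ (m + 1))) := by
    intro t _
    simp_rw [expNegPowIntegral_mul (m + 1) (hu _) t]
    rw [Finset.prod_mul_distrib, Finset.prod_const, Finset.card_univ, Fintype.card_fin,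
      ← integral_fintype_prod_eq_prod (fun _ x => Real.exp (-(t * x) ^ (m + 1))),
      ← Measure.restrict_pi_pi, ← volume_pi, ← mul_assoc, ← integral_const_mul]
    congr 1 with x
    rw [mul_comm (Real.exp _), mul_assoc, ← Real.exp_sum, ← Real.exp_add]
    congr 2
    simp only [mul_pow, Finset.sum_neg_distrib, ← Finset.mul_sum]
    ring
  have hm : ((m : ℝ) + 1) ≠ 0 := by positivity
  rw [setIntegral_congr_fun measurableSet_Ioi hprod, integral_integral_swap hint,
    setIntegral_congr_fun hBm hinner, integral_div, mul_div_cancel₀ _ hm]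
  rfl

lemma hasDerivAt_expNegPowIntegral_mul_pow (n m : ℕ) (u t : ℝ) :
    HasDerivAt (fun t => expNegPowIntegral n t * expNegPowIntegral n (u * t) ^ m)
      (Real.exp (-t ^ n) * expNegPowIntegral n (u * t) ^ m
        + m * (u * (Real.exp (-(u * t) ^ n) *
          (expNegPowIntegral n t * expNegPowIntegral n (u * t) ^ (m - 1))))) t := by
  have h1 : HasDerivAt (fun t => expNegPowIntegral n (u * t)) (Real.exp (-(u * t) ^ n) * u) t := by
    have := (hasDerivAt_expNegPowIntegral n (u * t)).comp t ((hasDerivAt_id t).const_mul u)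
    simpa using! this
  convert! (hasDerivAt_expNegPowIntegral n t).mul (h1.pow m) using 1
  rw [Pi.pow_apply]
  ring

/-- For `n ≥ 2` and `u > 0`,
`arctanₙ(u,…,u) + (n-1)·arctanₙ(1/u,1,…,1) = n · ((1/n)·Γ(1/n))ⁿ`. -/
theorem arctanN_diag_add_inv (n : ℕ) (hn : 2 ≤ n) (u : ℝ) (hu : 0 < u) :
    arctanN n (fun _ => u)
      + ((n : ℝ) - 1) * arctanN n (fun q => if q.val = 0 then 1 / u else 1)
      = n * ((1 / n) * Real.Gamma (1 / n)) ^ n := by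
  obtain ⟨k, rfl⟩ := Nat.exists_eq_add_of_le' hn
  set F := expNegPowIntegral (k + 2)
  set G : ℝ := (1 / (k + 2 : ℕ)) * Real.Gamma (1 / (k + 2 : ℕ))
  have hFnn : ∀ s, 0 ≤ s → 0 ≤ F s := fun s => expNegPowIntegral_nonneg _
  have hdiag := arctanN_eq_integral (m := k + 1) (fun _ => u) fun _ => hu.le
  have hinv := arctanN_eq_integral (m := k + 1) (fun q => if q.val = 0 then 1 / u else 1)
    fun q => by split_ifs <;> positivity
  have hscale : ∫ t in Ioi (0:ℝ), Real.exp (-t ^ (k + 2)) * (F (1 / u * t) * F t ^ k)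
      = ∫ t in Ioi (0:ℝ), u * (Real.exp (-(u * t) ^ (k + 2)) * (F t * F (u * t) ^ k)) := by
    have h := integral_comp_mul_left_Ioi'
      (fun t => Real.exp (-t ^ (k + 2)) * (F (1 / u * t) * F t ^ k)) 0 hu
    rw [mul_zero] at h
    rw [← h, integral_const_mul, smul_eq_mul]
    simp only [← mul_assoc, one_div, inv_mul_cancel₀ hu.ne', one_mul]
  simp only [Finset.prod_const, Finset.card_univ, Fintype.card_fin] at hdiag
  simp only [Fin.prod_univ_succ, Fin.val_zero, if_true, Fin.val_succ, Nat.succ_ne_zero, if_false,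
    Finset.prod_const, Finset.card_univ, Fintype.card_fin, one_mul] at hinv
  have hderiv := hasDerivAt_expNegPowIntegral_mul_pow (k + 2) (k + 1) u
  have hlim : Tendsto (fun t => F t * F (u * t) ^ (k + 1)) atTop (𝓝 (G * G ^ (k + 1))) := by
    have hFlim : Tendsto F atTop (𝓝 G) := tendsto_expNegPowIntegral_atTop (by omega)
    exact hFlim.mul ((hFlim.comp (tendsto_id.const_mul_atTop hu)).pow _)
  have hnn₁ : ∀ t ∈ Ioi (0:ℝ), 0 ≤ Real.exp (-t ^ (k + 2)) * F (u * t) ^ (k + 1) :=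
    fun t ht => mul_nonneg (Real.exp_pos _).le (pow_nonneg (hFnn _ (mul_pos hu ht).le) _)
  have hnn₂ : ∀ t ∈ Ioi (0:ℝ), 0 ≤ ((k + 1 : ℕ) : ℝ) *
      (u * (Real.exp (-(u * t) ^ (k + 2)) * (F t * F (u * t) ^ k))) := by
    intro t ht
    have h1 := hFnn t (le_of_lt ht)
    have h2 := hFnn (u * t) (mul_pos hu ht).le
    positivity
  have hnn := fun t ht => add_nonneg (hnn₁ t ht) (hnn₂ t ht)
  have htot := integral_Ioi_of_hasDerivAt_of_nonneg' (fun t _ => hderiv t) hnn hlim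
  have hint := integrableOn_Ioi_deriv_of_nonneg' (fun t _ => hderiv t) hnn hlim
  have hFc : Continuous F :=
    continuous_iff_continuousAt.2 fun t => (hasDerivAt_expNegPowIntegral _ t).continuousAt
  have hint₁ : IntegrableOn (fun t => Real.exp (-t ^ (k + 2)) * F (u * t) ^ (k + 1)) (Ioi 0) := by
    refine hint.mono' (Continuous.aestronglyMeasurable (by fun_prop)) ?_
    filter_upwards [ae_restrict_mem measurableSet_Ioi] with t ht
    rw [Real.norm_of_nonneg (hnn₁ t ht)]
    exact le_add_of_nonneg_right (hnn₂ t ht)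
  have hint₂ : IntegrableOn (fun t => ((k + 1 : ℕ) : ℝ) *
      (u * (Real.exp (-(u * t) ^ (k + 2)) * (F t * F (u * t) ^ k)))) (Ioi 0) := by
    refine hint.mono' (Continuous.aestronglyMeasurable (by fun_prop)) ?_
    filter_upwards [ae_restrict_mem measurableSet_Ioi] with t ht
    rw [Real.norm_of_nonneg (hnn₂ t ht)]
    exact le_add_of_nonneg_left (hnn₁ t ht)
  have hsplit := integral_add hint₁ hint₂
  rw [integral_const_mul, ← hscale] at hsplit
  have hsum := hsplit.symm.trans htot
  simp only [expNegPowIntegral_zero, zero_mul, sub_zero] at hsum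
  refine (congrArg₂ (fun a b => a + (((k + 2 : ℕ) : ℝ) - 1) * b) hdiag hinv).trans ?_
  rw [pow_succ' G (k + 1), ← hsum]
  push_cast
  ring
end

section
/- Let n ≥ 2 be a natural number. For positive reals u₁, …, u_{n-1}, define arctanₙ(u₁,…,u_{n-1}) = ∫₀^{u₁} ⋯ ∫₀^{u_{n-1}} 1/(1 + x₁ⁿ + ⋯ + x_{n-1}ⁿ) dx₁⋯dx_{n-1}, and for u > 0 define F(u) = arctanₙ(u, u, …, u) + (n-1) · arctanₙ(u, 1, …, 1). Then for every real u > 0, F(u) + F(1/u) = 2n · ((1/n) · Γ(1/n))ⁿ. -/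
open MeasureTheory

/-- `F(u) = arctanₙ(u,…,u) + (n-1)·arctanₙ(u,1,…,1)`. -/
noncomputable def Fn (n : ℕ) (u : ℝ) : ℝ :=
  arctanN n (fun _ => u)
    + ((n : ℝ) - 1) * arctanN n (fun q => if q.val = 0 then u else 1)

/-- The measure on `(0, ∞)` with density `exp (-x ^ n)`. -/
noncomputable def expNegPow (n : ℕ) : Measure ℝ :=
  (volume.restrict (Set.Ioi 0)).withDensity fun x => ENNReal.ofReal (Real.exp (-x ^ n))

lemma integrableOn_exp_neg_pow {n : ℕ} (hn : 0 < n) :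
    IntegrableOn (fun x : ℝ => Real.exp (-x ^ n)) (Set.Ioi 0) := by
  have h := integrableOn_rpow_mul_exp_neg_rpow (p := n) (s := 0) (by norm_num) (by positivity)
  simpa using h

instance (n : ℕ) [NeZero n] : IsFiniteMeasure (expNegPow n) :=
  isFiniteMeasure_withDensity_ofReal (integrableOn_exp_neg_pow (NeZero.pos n)).2

instance (n : ℕ) : NullSingletonClass (expNegPow n) := by
  unfold expNegPow; infer_instance

lemma integral_expNegPow (n : ℕ) (f : ℝ → ℝ) :
    ∫ x, f x ∂expNegPow n = ∫ x in Set.Ioi 0, Real.exp (-x ^ n) * f x := by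
  rw [expNegPow, integral_withDensity_eq_integral_toReal_smul (by fun_prop) (by simp)]
  simp [ENNReal.toReal_ofReal (Real.exp_pos _).le]

lemma ae_expNegPow_pos (n : ℕ) : ∀ᵐ x ∂expNegPow n, 0 < x :=
  (withDensity_absolutelyContinuous _ _).ae_le (ae_restrict_mem measurableSet_Ioi)

lemma expNegPow_real_univ {n : ℕ} (hn : 0 < n) :
    (expNegPow n).real Set.univ = 1 / n * Real.Gamma (1 / n) := by
  have h := integral_expNegPow n fun _ => 1
  have h' := integral_exp_neg_rpow (p := n) (by positivity)
  rw [Real.Gamma_add_one (by positivity)] at h'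
  simp only [smul_eq_mul, mul_one, integral_const] at h
  simp only [Real.rpow_natCast] at h'
  rw [h, h']

lemma expNegPow_real_Iic (n : ℕ) {s : ℝ} (hs : 0 ≤ s) :
    (expNegPow n).real (Set.Iic s) = ∫ x in 0..s, Real.exp (-x ^ n) := by
  rw [← integral_indicator_one measurableSet_Iic, integral_expNegPow,
    intervalIntegral.integral_of_le hs, ← Set.Ioi_inter_Iic,
    ← setIntegral_indicator measurableSet_Iic]
  congr with x
  by_cases hx : x ≤ s <;> simp [Set.indicator, hx]

lemma measureReal_prod_apply {α β : Type*} [MeasurableSpace α] [MeasurableSpace β] (μ : Measure α)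
    (ν : Measure β) [IsFiniteMeasure ν] [SFinite μ] {s : Set (α × β)} (hs : MeasurableSet s) :
    (μ.prod ν).real s = ∫ x, ν.real (Prod.mk x ⁻¹' s) ∂μ := by
  rw [measureReal_def, Measure.prod_apply hs]
  exact (integral_toReal (measurable_measure_prodMk_left hs).aemeasurable (by simp)).symm

/-- Peeling off the first coordinate of the product measure. -/
lemma pi_expNegPow_real (n m : ℕ) [NeZero n] {w : Fin m → ℝ} (hw : ∀ i, 0 ≤ w i) :
    (Measure.pi fun _ : Fin (m + 1) => expNegPow n).real {x | ∀ i : Fin m, x i.succ ≤ w i * x 0}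
      = ∫ t in Set.Ioi 0, Real.exp (-t ^ n) *
          ∏ i, ∫ y in 0..w i * t, Real.exp (-y ^ n) := by
  have hmp := measurePreserving_piFinSuccAbove (fun _ : Fin (m + 1) => expNegPow n) 0
  have hs : MeasurableSet {p : ℝ × (Fin m → ℝ) | ∀ i, p.2 i ≤ w i * p.1} := by
    rw [Set.ofPred_forall]
    exact MeasurableSet.iInter fun i => measurableSet_le (by fun_prop) (by fun_prop)
  have hpre : {x : Fin (m + 1) → ℝ | ∀ i : Fin m, x i.succ ≤ w i * x 0}
      = MeasurableEquiv.piFinSuccAbove (fun _ => ℝ) 0 ⁻¹'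
        {p : ℝ × (Fin m → ℝ) | ∀ i, p.2 i ≤ w i * p.1} := by
    ext x; exact Iff.rfl
  rw [hpre, hmp.measureReal_preimage hs.nullMeasurableSet, measureReal_prod_apply _ _ hs,
    integral_expNegPow]
  refine setIntegral_congr_fun measurableSet_Ioi fun t ht => ?_
  have hset : Prod.mk t ⁻¹' {p : ℝ × (Fin m → ℝ) | ∀ i, p.2 i ≤ w i * p.1}
      = Set.univ.pi fun i => Set.Iic (w i * t) := by
    ext y; exact ⟨fun h i _ => h i, fun h i => h i trivial⟩
  simp only [hset, measureReal_def, Measure.pi_pi, ENNReal.toReal_prod]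
  simp only [← measureReal_def, expNegPow_real_Iic n (mul_nonneg (hw _) (le_of_lt ht))]

lemma inv_eq_integral_pow_mul_exp (m : ℕ) {b : ℝ} (hb : 0 < b) :
    1 / b = (m + 1) * ∫ t in Set.Ioi (0 : ℝ), t ^ m * Real.exp (-b * t ^ (m + 1)) := by
  have h := integral_rpow_mul_exp_neg_mul_rpow (p := (m + 1 : ℕ)) (q := m) (b := b)
    (by positivity) (by linarith [m.cast_nonneg (α := ℝ)]) hb
  simp only [Real.rpow_natCast] at h
  have hm : (m + 1 : ℝ) ≠ 0 := by positivity
  rw [h]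
  push_cast
  rw [neg_div, div_self hm, Real.rpow_neg_one, Real.Gamma_one]
  field_simp

lemma arctanN_eq_measureReal (m : ℕ) {w : Fin m → ℝ} (hw : ∀ i, 0 ≤ w i) :
    arctanN (m + 1) w = (m + 1) * (Measure.pi fun _ : Fin (m + 1) => expNegPow (m + 1)).real
      {x | ∀ i : Fin m, x i.succ ≤ w i * x 0} := by
  rw [pi_expNegPow_real _ _ hw]
  let B : Set (Fin m → ℝ) := Set.univ.pi fun i => Set.Icc (0 : ℝ) (w i)
  have hB : MeasurableSet B := MeasurableSet.univ_pi fun i => measurableSet_Icc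
  have hBfin : IsFiniteMeasure (volume.restrict B) := by
    rw [isFiniteMeasure_restrict]
    exact (isCompact_univ_pi fun i => isCompact_Icc).measure_lt_top.ne
  have hint : Integrable (Function.uncurry fun (x : Fin m → ℝ) (t : ℝ) =>
      t ^ m * Real.exp (-(1 + ∑ i, x i ^ (m + 1)) * t ^ (m + 1)))
      ((volume.restrict B).prod (volume.restrict (Set.Ioi 0))) := by
    have h1 : Integrable (fun t : ℝ => t ^ m * Real.exp (-t ^ (m + 1)))
        (volume.restrict (Set.Ioi 0)) := by
      have h := integrableOn_rpow_mul_exp_neg_rpow (p := (m + 1 : ℕ)) (s := m)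
        (by linarith [m.cast_nonneg (α := ℝ)]) (by positivity)
      simp only [Real.rpow_natCast] at h
      exact h
    refine ((integrable_const (μ := volume.restrict B) (1 : ℝ)).mul_prod h1).mono'
      (by fun_prop) ?_
    rw [Measure.prod_restrict]
    filter_upwards [ae_restrict_mem (hB.prod measurableSet_Ioi)] with ⟨x, t⟩ ⟨hx, ht⟩
    have ht : 0 < t := ht
    have hsum : 0 ≤ ∑ i, x i ^ (m + 1) :=
      Finset.sum_nonneg fun i _ => pow_nonneg (hx i (Set.mem_univ i)).1 _
    simp only [Function.uncurry, one_mul]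
    rw [Real.norm_of_nonneg (by positivity)]
    gcongr
    nlinarith [pow_pos ht (m + 1)]
  calc arctanN (m + 1) w
      = ∫ x in B, (m + 1) * ∫ t in Set.Ioi (0 : ℝ),
          t ^ m * Real.exp (-(1 + ∑ i, x i ^ (m + 1)) * t ^ (m + 1)) := by
        refine setIntegral_congr_fun hB fun x hx => ?_
        have hsum : 0 ≤ ∑ i, x i ^ (m + 1) :=
          Finset.sum_nonneg fun i _ => pow_nonneg (hx i (Set.mem_univ i)).1 _
        exact inv_eq_integral_pow_mul_exp m (b := 1 + ∑ i, x i ^ (m + 1)) (by positivity)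
    _ = (m + 1) * ∫ t in Set.Ioi (0 : ℝ), ∫ x in B,
          t ^ m * Real.exp (-(1 + ∑ i, x i ^ (m + 1)) * t ^ (m + 1)) := by
        rw [integral_const_mul, integral_integral_swap hint]
    _ = _ := by
        congr 1
        refine setIntegral_congr_fun measurableSet_Ioi fun t _ => ?_
        have hprod : ∀ x : Fin m → ℝ,
            t ^ m * Real.exp (-(1 + ∑ i, x i ^ (m + 1)) * t ^ (m + 1))
              = Real.exp (-t ^ (m + 1)) * ∏ i, t * Real.exp (-(t * x i) ^ (m + 1)) := fun x => by
          rw [Finset.prod_mul_distrib, ← Real.exp_sum, Finset.prod_const, Finset.card_univ,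
            Fintype.card_fin, mul_left_comm, ← Real.exp_add]
          congr 2
          simp only [mul_pow, Finset.sum_neg_distrib, ← Finset.mul_sum]
          ring
        simp only [hprod, integral_const_mul]
        congr 1
        rw [volume_pi, Measure.restrict_pi_pi,
          integral_fintype_prod_eq_prod (fun _ y => t * Real.exp (-(t * y) ^ (m + 1)))]
        refine Finset.prod_congr rfl fun i _ => ?_
        rw [integral_const_mul, integral_Icc_eq_integral_Ioc,
          ← intervalIntegral.integral_of_le (hw i),
          intervalIntegral.mul_integral_comp_mul_left (f := fun y => Real.exp (-y ^ (m + 1))),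
          mul_zero, mul_comm t]

/-- The vectors whose coordinates, relative to the `j`-th one, have ratio at most `c` at `k` and at
most `d` at every other index. -/
def ratioSet {ι : Type*} (c d : ℝ) (j k : ι) : Set (ι → ℝ) :=
  {x | x k ≤ c * x j ∧ ∀ i, i ≠ j → i ≠ k → x i ≤ d * x j}

/-- The vectors whose coordinates have ratio at most `c` to the `j`-th one. -/
def ratioSetAll {ι : Type*} (c : ℝ) (j : ι) : Set (ι → ℝ) :=
  {x | ∀ i, i ≠ j → x i ≤ c * x j}

open scoped Classical in
lemma sum_indicator_ratioSet {ι : Type*} [Fintype ι] [Nontrivial ι] {u : ℝ} (hu : 1 ≤ u)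
    {x : ι → ℝ} (hx : ∀ i, 0 < x i) (hne : ∀ i j, i ≠ j → x i ≠ x j)
    (hneu : ∀ i j, i ≠ j → x i ≠ u * x j) :
    ∑ j, ((ratioSetAll u j).indicator 1 x + (ratioSetAll (1 / u) j).indicator 1 x
      + ∑ k ∈ Finset.univ.erase j, ((ratioSet u 1 j k).indicator 1 x
        + (ratioSet (1 / u) 1 j k).indicator 1 x)) = (2 * Fintype.card ι : ℝ) := by
  have hu0 : 0 < u := by linarith
  obtain ⟨m, -, hm⟩ := Finset.exists_max_image Finset.univ x Finset.univ_nonempty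
  have hm' : ∀ i, i ≠ m → x i < x m := fun i hi =>
    lt_of_le_of_ne (hm i (Finset.mem_univ i)) (hne i m hi)
  have hE : (Finset.univ.erase m).Nonempty := by
    obtain ⟨s, hs⟩ := exists_ne m
    exact ⟨s, by simp [hs]⟩
  obtain ⟨s, hs, hs'⟩ := Finset.exists_max_image (Finset.univ.erase m) x hE
  have hsm : s ≠ m := by simpa using hs
  have hs'' : ∀ i, i ≠ m → x i ≤ x s := fun i hi => hs' i (by simp [hi])
  have hle : ∀ i, x i ≤ u * x i := fun i => by nlinarith [hx i]
  have inv_iff : ∀ i j, x i ≤ 1 / u * x j ↔ u * x i ≤ x j := fun i j => by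
    rw [one_div, le_inv_mul_iff₀ hu0]
  -- the four families of indicators, in terms of the largest and second largest coordinates
  have h1 : ∀ j, (ratioSetAll u j).indicator (1 : (ι → ℝ) → ℝ) x
      = if x m ≤ u * x j then 1 else 0 := fun j => by
    rw [Set.indicator_apply]
    refine if_congr ⟨fun h => ?_, fun h i _ => (hm i (Finset.mem_univ i)).trans h⟩ rfl rfl
    by_cases hj : m = j
    · subst hj; exact hle _
    · exact h m hj
  have h2 : ∀ j, (ratioSetAll (1 / u) j).indicator (1 : (ι → ℝ) → ℝ) x
      = if j = m then (if u * x s ≤ x m then 1 else 0) else 0 := fun j => by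
    rw [Set.indicator_apply, ← ite_and]
    refine if_congr ⟨fun h => ?_, ?_⟩ rfl rfl
    · have hj : j = m := by
        by_contra hj
        have h' := (inv_iff _ _).1 (h m (Ne.symm hj))
        linarith [hm' j hj, hle m]
      subst hj
      exact ⟨rfl, (inv_iff _ _).1 (h s hsm)⟩
    · rintro ⟨rfl, h⟩ i hi
      rw [inv_iff]
      nlinarith [hs'' i hi]
  have h3 : ∀ j, ∑ k ∈ Finset.univ.erase j, (ratioSet u 1 j k).indicator (1 : (ι → ℝ) → ℝ) x
      = (if j = m then (Fintype.card ι - 1 : ℝ) else 0)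
        + if j = s then (if x m ≤ u * x s then 1 else 0) else 0 := fun j => by
    by_cases hj : j = m
    · subst hj
      rw [if_pos rfl, if_neg (Ne.symm hsm), add_zero]
      have : ∀ k ∈ Finset.univ.erase j,
          (ratioSet u 1 j k).indicator (1 : (ι → ℝ) → ℝ) x = 1 := fun k _ => by
        refine Set.indicator_of_mem (s := ratioSet u 1 j k)
          ⟨(hm k (Finset.mem_univ k)).trans (hle j), fun i _ _ => ?_⟩ _
        rw [one_mul]; exact hm i (Finset.mem_univ i)
      rw [Finset.sum_congr rfl this]
      simp [Finset.card_erase_of_mem, Nat.cast_sub Fintype.card_pos]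
    · rw [if_neg hj, zero_add, Finset.sum_eq_single m]
      · rw [Set.indicator_apply, ← ite_and]
        refine if_congr ⟨fun h => ?_, ?_⟩ rfl rfl
        · have : j = s := by
            by_contra hjs
            have h' := h.2 s (Ne.symm hjs) hsm
            rw [one_mul] at h'
            exact hne j s hjs (le_antisymm (hs'' j hj) h')
          exact ⟨this, this ▸ h.1⟩
        · rintro ⟨rfl, h⟩
          exact ⟨h, fun i _ hi => by rw [one_mul]; exact hs'' i hi⟩
      · refine fun k _ hkm => Set.indicator_of_notMem (fun h => ?_) _
        have h' := h.2 m (Ne.symm hj) (Ne.symm hkm)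
        linarith [hm' j hj]
      · exact fun h => absurd (Finset.mem_erase.2 ⟨Ne.symm hj, Finset.mem_univ m⟩) h
  have h4 : ∀ j, ∑ k ∈ Finset.univ.erase j,
        (ratioSet (1 / u) 1 j k).indicator (1 : (ι → ℝ) → ℝ) x
      = if j = m then ∑ k ∈ Finset.univ.erase m, (if u * x k ≤ x m then 1 else 0) else 0 :=
      fun j => by
    by_cases hj : j = m
    · subst hj
      rw [if_pos rfl]
      refine Finset.sum_congr rfl fun k _ => ?_
      rw [Set.indicator_apply]
      refine if_congr ⟨fun h => (inv_iff _ _).1 h.1, fun h => ⟨(inv_iff _ _).2 h, fun i _ _ => ?_⟩⟩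
        rfl rfl
      rw [one_mul]; exact hm i (Finset.mem_univ i)
    · rw [if_neg hj]
      refine Finset.sum_eq_zero fun k _ => Set.indicator_of_notMem (fun h => ?_) _
      by_cases hkm : k = m
      · subst hkm
        have h' := (inv_iff _ _).1 h.1
        linarith [hm' j hj, hle k]
      · have h' := h.2 m (Ne.symm hj) (Ne.symm hkm)
        linarith [hm' j hj]
  have compl : ∀ k, k ≠ m → ((if x m ≤ u * x k then 1 else 0)
      + (if u * x k ≤ x m then 1 else 0) : ℝ) = 1 := fun k hk => by
    rcases lt_or_gt_of_ne (hneu m k hk.symm) with h | h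
    · simp [h.le, h.not_ge]
    · simp [h.le, h.not_ge]
  have h14 : ∑ j, (if x m ≤ u * x j then 1 else 0 : ℝ)
      + ∑ k ∈ Finset.univ.erase m, (if u * x k ≤ x m then 1 else 0) = Fintype.card ι := by
    rw [← Finset.add_sum_erase _ _ (Finset.mem_univ m), if_pos (hle m), add_assoc,
      ← Finset.sum_add_distrib, Finset.sum_congr rfl fun k hk => compl k (Finset.ne_of_mem_erase hk)]
    simp [Finset.card_erase_of_mem, Nat.cast_sub Fintype.card_pos]
  simp only [Finset.sum_add_distrib, h1, h2, h3, h4, Finset.sum_ite_eq', Finset.mem_univ, if_true]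
  linarith [compl s hsm]

lemma pi_measureReal_comp_perm {ι α : Type*} [Fintype ι] [MeasurableSpace α] (μ : Measure α)
    [SigmaFinite μ] (σ : Equiv.Perm ι) {s : Set (ι → α)} (hs : MeasurableSet s) :
    (Measure.pi fun _ : ι => μ).real ((fun x => x ∘ σ) ⁻¹' s)
      = (Measure.pi fun _ : ι => μ).real s := by
  have h := (measurePreserving_piCongrLeft (fun _ : ι => μ) σ.symm).measureReal_preimage
    hs.nullMeasurableSet
  rw [← h]
  congr 2
  ext x i
  have h' := Equiv.piCongrLeft_apply_apply (fun _ : ι => α) σ.symm x (σ i)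
  rw [σ.symm_apply_apply] at h'
  exact h'.symm

lemma exists_perm_apply_eq_apply_eq {ι : Type*} {a b j k : ι} (hab : a ≠ b) (hjk : j ≠ k) :
    ∃ σ : Equiv.Perm ι, σ a = j ∧ σ b = k := by
  classical
  have h : Equiv.swap a j b ≠ j := fun h => hab <| (Equiv.swap a j).injective
    ((Equiv.swap_apply_left a j).trans h.symm)
  refine ⟨(Equiv.swap a j).trans (Equiv.swap (Equiv.swap a j b) k), ?_, ?_⟩
  · simp [Equiv.swap_apply_of_ne_of_ne h.symm hjk]
  · simp

section Exchangeability

variable {ι : Type*} [Fintype ι]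

lemma measurableSet_ratioSet (c d : ℝ) (j k : ι) : MeasurableSet (ratioSet c d j k) := by
  unfold ratioSet
  measurability

lemma measurableSet_ratioSetAll (c : ℝ) (j : ι) : MeasurableSet (ratioSetAll c j) := by
  unfold ratioSetAll
  measurability

lemma measureReal_ratioSet (μ : Measure ℝ) [SigmaFinite μ] (c d : ℝ) {a b j k : ι} (hab : a ≠ b)
    (hjk : j ≠ k) : (Measure.pi fun _ : ι => μ).real (ratioSet c d j k)
      = (Measure.pi fun _ : ι => μ).real (ratioSet c d a b) := by
  obtain ⟨σ, rfl, rfl⟩ := exists_perm_apply_eq_apply_eq hab hjk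
  rw [← pi_measureReal_comp_perm μ σ (measurableSet_ratioSet c d a b)]
  congr 1
  ext x
  refine and_congr Iff.rfl ?_
  rw [σ.symm.forall_congr_left]
  simp

lemma measureReal_ratioSetAll (μ : Measure ℝ) [SigmaFinite μ] (c : ℝ) (a j : ι) :
    (Measure.pi fun _ : ι => μ).real (ratioSetAll c j)
      = (Measure.pi fun _ : ι => μ).real (ratioSetAll c a) := by
  classical
  obtain ⟨σ, rfl⟩ : ∃ σ : Equiv.Perm ι, σ a = j := ⟨Equiv.swap a j, Equiv.swap_apply_left a j⟩
  rw [← pi_measureReal_comp_perm μ σ (measurableSet_ratioSetAll c a)]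
  congr 1
  ext x
  change (∀ i, i ≠ σ a → x i ≤ c * x (σ a)) ↔ ∀ i, i ≠ a → x (σ i) ≤ c * x (σ a)
  rw [σ.symm.forall_congr_left]
  simp

end Exchangeability

lemma ae_pi_ne_mul {m : ℕ} (μ : Measure ℝ) [SigmaFinite μ] [NullSingletonClass μ] (c : ℝ)
    {i j : Fin (m + 1)} (hij : i ≠ j) :
    ∀ᵐ x ∂Measure.pi fun _ : Fin (m + 1) => μ, x i ≠ c * x j := by
  obtain ⟨k, rfl⟩ := Fin.exists_succAbove_eq hij
  have hmp := measurePreserving_piFinSuccAbove (fun _ : Fin (m + 1) => μ) j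
  have hs : MeasurableSet {p : ℝ × (Fin m → ℝ) | p.2 k ≠ c * p.1} :=
    (measurableSet_eq_fun (by fun_prop) (by fun_prop)).compl
  refine hmp.quasiMeasurePreserving.ae (p := fun p => p.2 k ≠ c * p.1) ?_
  rw [Measure.ae_prod_iff_ae_ae hs]
  filter_upwards with t
  rw [ae_iff]
  simpa using Measure.pi_hyperplane (fun _ : Fin m => μ) k (c * t)

lemma sum_measureReal_ratioSet {m : ℕ} (μ : Measure ℝ) [IsFiniteMeasure μ] [NullSingletonClass μ]
    (hμ : ∀ᵐ x ∂μ, 0 < x) {u : ℝ} (hu : 1 ≤ u) :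
    (Measure.pi fun _ : Fin (m + 2) => μ).real (ratioSetAll u 0)
      + (Measure.pi fun _ : Fin (m + 2) => μ).real (ratioSetAll (1 / u) 0)
      + (m + 1) * ((Measure.pi fun _ : Fin (m + 2) => μ).real (ratioSet u 1 0 1)
        + (Measure.pi fun _ : Fin (m + 2) => μ).real (ratioSet (1 / u) 1 0 1))
      = 2 * μ.real Set.univ ^ (m + 2) := by
  classical
  set P := Measure.pi fun _ : Fin (m + 2) => μ with hP
  have hpos : ∀ᵐ x ∂P, ∀ i, 0 < x i :=
    ae_all_iff.2 fun i => (Measure.quasiMeasurePreserving_eval _ i).ae hμ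
  have hne : ∀ c : ℝ, ∀ᵐ x ∂P, ∀ i j, i ≠ j → x i ≠ c * x j := fun c =>
    ae_all_iff.2 fun i => ae_all_iff.2 fun j => Filter.eventually_imp_distrib_left.2
      fun hij => ae_pi_ne_mul μ c hij
  have hae : ∀ᵐ x ∂P, ∑ j, ((ratioSetAll u j).indicator 1 x
      + (ratioSetAll (1 / u) j).indicator 1 x
      + ∑ k ∈ Finset.univ.erase j, ((ratioSet u 1 j k).indicator 1 x
        + (ratioSet (1 / u) 1 j k).indicator 1 x)) = (2 * (m + 2) : ℝ) := by
    filter_upwards [hpos, hne 1, hne u] with x h0 h1 h2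
    simpa using sum_indicator_ratioSet hu h0 (by simpa using h1) h2
  have hA : ∀ c (j : Fin (m + 2)),
      Integrable ((ratioSetAll c j).indicator (1 : (Fin (m + 2) → ℝ) → ℝ)) P := fun c j =>
    (integrable_const (1 : ℝ)).indicator (measurableSet_ratioSetAll c j)
  have hR : ∀ c (j k : Fin (m + 2)),
      Integrable ((ratioSet c 1 j k).indicator (1 : (Fin (m + 2) → ℝ) → ℝ)) P := fun c j k =>
    (integrable_const (1 : ℝ)).indicator (measurableSet_ratioSet c 1 j k)
  have hRR : ∀ j k : Fin (m + 2), Integrable (fun x =>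
      (ratioSet u 1 j k).indicator (1 : (Fin (m + 2) → ℝ) → ℝ) x
        + (ratioSet (1 / u) 1 j k).indicator 1 x) P := fun j k => (hR u j k).add (hR (1 / u) j k)
  have hAA : ∀ j : Fin (m + 2), Integrable (fun x =>
      (ratioSetAll u j).indicator (1 : (Fin (m + 2) → ℝ) → ℝ) x
        + (ratioSetAll (1 / u) j).indicator 1 x) P := fun j => (hA u j).add (hA (1 / u) j)
  have hS : ∀ j : Fin (m + 2), Integrable (fun x => ∑ k ∈ Finset.univ.erase j,
      ((ratioSet u 1 j k).indicator (1 : (Fin (m + 2) → ℝ) → ℝ) x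
        + (ratioSet (1 / u) 1 j k).indicator 1 x)) P := fun j =>
    integrable_finsetSum _ fun k _ => hRR j k
  have hAS : ∀ j : Fin (m + 2), Integrable (fun x =>
      (ratioSetAll u j).indicator (1 : (Fin (m + 2) → ℝ) → ℝ) x
      + (ratioSetAll (1 / u) j).indicator 1 x
      + ∑ k ∈ Finset.univ.erase j, ((ratioSet u 1 j k).indicator 1 x
        + (ratioSet (1 / u) 1 j k).indicator 1 x)) P := fun j => (hAA j).add (hS j)
  have h := integral_congr_ae hae
  rw [integral_finsetSum _ fun j _ => hAS j] at h
  have hj : ∀ j : Fin (m + 2), ∫ x, ((ratioSetAll u j).indicator (1 : (Fin (m + 2) → ℝ) → ℝ) x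
      + (ratioSetAll (1 / u) j).indicator 1 x
      + ∑ k ∈ Finset.univ.erase j, ((ratioSet u 1 j k).indicator 1 x
        + (ratioSet (1 / u) 1 j k).indicator 1 x)) ∂P
      = P.real (ratioSetAll u 0) + P.real (ratioSetAll (1 / u) 0)
        + (m + 1) * (P.real (ratioSet u 1 0 1) + P.real (ratioSet (1 / u) 1 0 1)) := fun j => by
    rw [integral_add (hAA j) (hS j), integral_add (hA u j) (hA (1 / u) j),
      integral_finsetSum _ fun k _ => hRR j k,
      integral_indicator_one (measurableSet_ratioSetAll _ _),
      integral_indicator_one (measurableSet_ratioSetAll _ _),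
      measureReal_ratioSetAll μ u 0 j, measureReal_ratioSetAll μ (1 / u) 0 j]
    congr 1
    have hk : ∀ k ∈ Finset.univ.erase j,
        ∫ x, ((ratioSet u 1 j k).indicator (1 : (Fin (m + 2) → ℝ) → ℝ) x
          + (ratioSet (1 / u) 1 j k).indicator 1 x) ∂P
        = P.real (ratioSet u 1 0 1) + P.real (ratioSet (1 / u) 1 0 1) := fun k hk => by
      have hjk : j ≠ k := (Finset.ne_of_mem_erase hk).symm
      rw [integral_add (hR u j k) (hR (1 / u) j k),
        integral_indicator_one (measurableSet_ratioSet _ _ _ _),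
        integral_indicator_one (measurableSet_ratioSet _ _ _ _),
        measureReal_ratioSet μ u 1 zero_ne_one hjk,
        measureReal_ratioSet μ (1 / u) 1 zero_ne_one hjk]
    rw [Finset.sum_congr rfl hk]
    simp [Finset.card_erase_of_mem, mul_add]
  have huniv : P.real Set.univ = μ.real Set.univ ^ (m + 2) := by
    simp [hP, measureReal_def, Measure.pi_univ]
  rw [Finset.sum_congr rfl fun j _ => hj j, integral_const, huniv] at h
  simp only [Finset.sum_const, Finset.card_univ, Fintype.card_fin, nsmul_eq_mul, smul_eq_mul] at h
  push_cast at h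
  have hm : (m + 2 : ℝ) ≠ 0 := by positivity
  apply mul_left_cancel₀ hm
  linarith

lemma Fn_eq_measureReal (m : ℕ) {c : ℝ} (hc : 0 ≤ c) :
    Fn (m + 2) c = (m + 2) *
      ((Measure.pi fun _ : Fin (m + 2) => expNegPow (m + 2)).real (ratioSetAll c 0)
      + (m + 1) * (Measure.pi fun _ : Fin (m + 2) => expNegPow (m + 2)).real
        (ratioSet c 1 0 1)) := by
  have h1 := arctanN_eq_measureReal (m + 1) (w := fun _ => c) fun _ => hc
  have h2 := arctanN_eq_measureReal (m + 1) (w := fun q => if q.val = 0 then c else 1)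
    fun i => by split_ifs <;> positivity
  have s1 : {x : Fin (m + 2) → ℝ | ∀ i : Fin (m + 1), x i.succ ≤ c * x 0} = ratioSetAll c 0 := by
    ext x
    change _ ↔ ∀ i, i ≠ 0 → x i ≤ c * x 0
    rw [Fin.forall_fin_succ]
    simp
  have s2 : {x : Fin (m + 2) → ℝ | ∀ i : Fin (m + 1), x i.succ ≤ (if i.val = 0 then c else 1) * x 0}
      = ratioSet c 1 0 1 := by
    ext x
    change (∀ i : Fin (m + 1), x i.succ ≤ (if i.val = 0 then c else 1) * x 0) ↔
      x 1 ≤ c * x 0 ∧ ∀ i, i ≠ 0 → i ≠ 1 → x i ≤ 1 * x 0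
    rw [Fin.forall_fin_succ, Fin.forall_fin_succ (n := m + 1)]
    rw [Fin.forall_fin_succ (n := m) (P := fun i => i.succ ≠ 0 → i.succ ≠ 1 → _)]
    simp [Fin.ext_iff]
  rw [s1] at h1
  rw [s2] at h2
  unfold Fn
  rw [show arctanN (m + 2) (fun _ => c) = _ from h1,
    show arctanN (m + 2) (fun q => if q.val = 0 then c else 1) = _ from h2]
  push_cast
  ring

lemma Fn_add_Fn_inv_of_one_le (m : ℕ) {u : ℝ} (hu : 1 ≤ u) :
    Fn (m + 2) u + Fn (m + 2) (1 / u)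
      = 2 * (m + 2 : ℕ) * ((1 / (m + 2 : ℕ)) * Real.Gamma (1 / (m + 2 : ℕ))) ^ (m + 2) := by
  have h := sum_measureReal_ratioSet (m := m) (expNegPow (m + 2)) (ae_expNegPow_pos _) hu
  rw [expNegPow_real_univ (Nat.succ_pos _)] at h
  rw [Fn_eq_measureReal m (by positivity), Fn_eq_measureReal m (by positivity), mul_right_comm, ← h]
  push_cast
  ring

/-- For `n ≥ 2` and `u > 0`,
`F(u) + F(1/u) = 2n · ((1/n)·Γ(1/n))ⁿ`. -/
theorem Fn_add_Fn_inv (n : ℕ) (hn : 2 ≤ n) (u : ℝ) (hu : 0 < u) :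
    Fn n u + Fn n (1 / u) = 2 * n * ((1 / n) * Real.Gamma (1 / n)) ^ n := by
  obtain ⟨m, rfl⟩ := Nat.exists_eq_add_of_le' hn
  rcases le_total 1 u with h | h
  · exact Fn_add_Fn_inv_of_one_le m h
  · have h' := Fn_add_Fn_inv_of_one_le m (one_le_one_div hu h)
    rwa [one_div_one_div, add_comm] at h'
end

section
/- For positive reals a, b, c, define arctan₄(a,b,c) = ∫₀^a ∫₀^b ∫₀^c 1/(1 + x⁴ + y⁴ + z⁴) dx dy dz, and for u, v > 0 define Φ(u,v) = arctan₄(u, v, u/v) + arctan₄(u/v, 1/v, u/v²). Then for all real numbers u > 0 and v > 0, Φ(u,v) + Φ(1/u, 1/v) = 4 · ((1/4) · Γ(1/4))⁴. -/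
open MeasureTheory

/-- The fourth-order arctan: the Lebesgue integral of
`(x,y,z) ↦ 1/(1 + x⁴ + y⁴ + z⁴)` over the box `[0,a] × [0,b] × [0,c]`. -/
noncomputable def arctan4 (a b c : ℝ) : ℝ :=
  ∫ p in Set.Icc (0:ℝ) a ×ˢ Set.Icc (0:ℝ) b ×ˢ Set.Icc (0:ℝ) c,
    1 / (1 + p.1 ^ 4 + p.2.1 ^ 4 + p.2.2 ^ 4)

/-- `Φ(u,v) = arctan₄(u,v,u/v) + arctan₄(u/v,1/v,u/v²)`. -/
noncomputable def Phi (u v : ℝ) : ℝ :=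
  arctan4 u v (u / v) + arctan4 (u / v) (1 / v) (u / v ^ 2)

open Filter Topology Set

/-- The incomplete integral `∫₀ᵗ exp (-x⁴) dx`. -/
noncomputable def quarticErf (t : ℝ) : ℝ := ∫ x in (0:ℝ)..t, Real.exp (-x ^ 4)

lemma hasDerivAt_quarticErf (t : ℝ) : HasDerivAt quarticErf (Real.exp (-t ^ 4)) t := by
  have hc : Continuous fun x : ℝ => Real.exp (-x ^ 4) := by fun_prop
  exact intervalIntegral.integral_hasDerivAt_right (hc.intervalIntegrable _ _)
    (hc.stronglyMeasurableAtFilter _ _) hc.continuousAt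

lemma continuous_quarticErf : Continuous quarticErf :=
  continuous_iff_continuousAt.2 fun t => (hasDerivAt_quarticErf t).continuousAt

@[simp] lemma quarticErf_zero : quarticErf 0 = 0 := by simp [quarticErf]

lemma quarticErf_nonneg {t : ℝ} (ht : 0 ≤ t) : 0 ≤ quarticErf t :=
  intervalIntegral.integral_nonneg ht fun _ _ => (Real.exp_pos _).le

lemma integrableOn_exp_neg_pow_four : IntegrableOn (fun x : ℝ => Real.exp (-x ^ 4)) (Ioi 0) := by
  have h := integrableOn_rpow_mul_exp_neg_rpow (p := 4) (s := 0) (by norm_num) (by norm_num)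
  refine h.congr_fun (fun x _ => ?_) measurableSet_Ioi
  norm_num

lemma integral_exp_neg_pow_four :
    ∫ x in Ioi (0:ℝ), Real.exp (-x ^ 4) = 1 / 4 * Real.Gamma (1 / 4) := by
  have h := integral_exp_neg_rpow (p := 4) (by norm_num)
  rw [Real.Gamma_add_one (by norm_num)] at h
  rw [← h]
  refine setIntegral_congr_fun measurableSet_Ioi fun x _ => ?_
  norm_num

lemma tendsto_quarticErf_atTop :
    Tendsto quarticErf atTop (𝓝 (1 / 4 * Real.Gamma (1 / 4))) := by
  rw [← integral_exp_neg_pow_four]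
  exact intervalIntegral_tendsto_integral_Ioi 0 integrableOn_exp_neg_pow_four tendsto_id

lemma monotone_quarticErf : Monotone quarticErf :=
  monotone_of_hasDerivAt_nonneg hasDerivAt_quarticErf fun _ => (Real.exp_pos _).le

lemma quarticErf_le (t : ℝ) : quarticErf t ≤ 1 / 4 * Real.Gamma (1 / 4) :=
  monotone_quarticErf.ge_of_tendsto tendsto_quarticErf_atTop t

section radialKernel

variable {k : ℝ}

private lemma hasDerivAt_radial (hk : 0 < k) (t : ℝ) :
    HasDerivAt (fun t : ℝ => -(k⁻¹ * Real.exp (-(k * t ^ 4))))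
      (4 * t ^ 3 * Real.exp (-(k * t ^ 4))) t := by
  have h := ((((hasDerivAt_pow 4 t).const_mul k).neg.exp).const_mul k⁻¹).neg
  refine h.congr_deriv ?_
  simp only [Pi.neg_apply]
  field_simp
  norm_num
  ring

private lemma tendsto_radial (hk : 0 < k) :
    Tendsto (fun t : ℝ => -(k⁻¹ * Real.exp (-(k * t ^ 4)))) atTop (𝓝 0) := by
  have h : Tendsto (fun t : ℝ => Real.exp (-(k * t ^ 4))) atTop (𝓝 0) :=
    Real.tendsto_exp_atBot.comp (tendsto_neg_atTop_atBot.comp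
      ((tendsto_pow_atTop (by norm_num)).const_mul_atTop hk))
  simpa using (h.const_mul k⁻¹).neg

lemma integrableOn_pow_three_mul_exp (hk : 0 < k) :
    IntegrableOn (fun t : ℝ => 4 * t ^ 3 * Real.exp (-(k * t ^ 4))) (Ioi 0) :=
  integrableOn_Ioi_deriv_of_nonneg' (fun t _ => hasDerivAt_radial hk t)
    (fun t ht => by have : 0 < t := ht; positivity) (tendsto_radial hk)

lemma integral_pow_three_mul_exp (hk : 0 < k) :
    ∫ t in Ioi (0:ℝ), 4 * t ^ 3 * Real.exp (-(k * t ^ 4)) = 1 / k := by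
  rw [integral_Ioi_of_hasDerivAt_of_nonneg' (fun t _ => hasDerivAt_radial hk t)
    (fun t ht => by have : 0 < t := ht; positivity) (tendsto_radial hk)]
  simp

end radialKernel

lemma mul_integral_exp_neg_mul_pow_four {a : ℝ} (ha : 0 ≤ a) (t : ℝ) :
    t * ∫ x in Icc 0 a, Real.exp (-(t * x) ^ 4) = quarticErf (a * t) := by
  rw [integral_Icc_eq_integral_Ioc, ← intervalIntegral.integral_of_le ha,
    intervalIntegral.mul_integral_comp_mul_left (f := fun x => Real.exp (-x ^ 4)), mul_zero,
    mul_comm t a, quarticErf]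

lemma arctan4_eq_integral_quarticErf {a b c : ℝ} (ha : 0 ≤ a) (hb : 0 ≤ b) (hc : 0 ≤ c) :
    arctan4 a b c = 4 * ∫ t in Ioi (0:ℝ),
      Real.exp (-t ^ 4) * (quarticErf (a * t) * (quarticErf (b * t) * quarticErf (c * t))) := by
  set B : Set (ℝ × ℝ × ℝ) := Icc 0 a ×ˢ Icc 0 b ×ˢ Icc 0 c with hB
  have hBc : IsCompact B := isCompact_Icc.prod (isCompact_Icc.prod isCompact_Icc)
  let f : ℝ × ℝ × ℝ → ℝ → ℝ := fun p t =>
    4 * t ^ 3 * Real.exp (-((1 + p.1 ^ 4 + p.2.1 ^ 4 + p.2.2 ^ 4) * t ^ 4))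
  have hf : Integrable (Function.uncurry f)
      ((volume.restrict B).prod (volume.restrict (Ioi 0))) := by
    have h1 : Integrable (fun _ : ℝ × ℝ × ℝ => (1:ℝ)) (volume.restrict B) :=
      continuous_const.continuousOn.integrableOn_compact hBc
    have hdom := h1.mul_prod (integrableOn_pow_three_mul_exp one_pos)
    refine hdom.mono (Continuous.aestronglyMeasurable (by fun_prop)) ?_
    refine Eventually.of_forall fun z => ?_
    obtain ⟨p, t⟩ := z
    simp only [f, Function.uncurry_apply_pair, norm_mul, one_mul, Real.norm_eq_abs,
      Real.abs_exp]
    gcongr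
    have h : 0 ≤ p.1 ^ 4 + p.2.1 ^ 4 + p.2.2 ^ 4 := by positivity
    have h' : (0:ℝ) ≤ t ^ 4 := by positivity
    nlinarith
  calc arctan4 a b c = ∫ p in B, ∫ t in Ioi (0:ℝ), f p t := by
        refine integral_congr_ae (Eventually.of_forall fun p => ?_)
        exact (integral_pow_three_mul_exp (by positivity)).symm
    _ = ∫ t in Ioi (0:ℝ), ∫ p in B, f p t := integral_integral_swap hf
    _ = _ := by
        rw [← integral_const_mul]
        refine integral_congr_ae (Eventually.of_forall fun t => ?_)
        simp only
        have hsplit : ∀ p : ℝ × ℝ × ℝ, f p t = 4 * t ^ 3 * Real.exp (-t ^ 4) *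
            (Real.exp (-(t * p.1) ^ 4) *
              (Real.exp (-(t * p.2.1) ^ 4) * Real.exp (-(t * p.2.2) ^ 4))) := by
          intro p
          simp only [f, mul_assoc, ← Real.exp_add]
          congr 4
          ring
        simp only [hsplit]
        rw [integral_const_mul, hB, Measure.volume_eq_prod,
          setIntegral_prod_mul (fun x => Real.exp (-(t * x) ^ 4))
            (fun q : ℝ × ℝ => Real.exp (-(t * q.1) ^ 4) * Real.exp (-(t * q.2) ^ 4)),
          Measure.volume_eq_prod,
          setIntegral_prod_mul (fun x => Real.exp (-(t * x) ^ 4))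
            (fun x => Real.exp (-(t * x) ^ 4)),
          ← mul_integral_exp_neg_mul_pow_four ha, ← mul_integral_exp_neg_mul_pow_four hb,
          ← mul_integral_exp_neg_mul_pow_four hc]
        ring

lemma arctan4_comm {a b c : ℝ} (ha : 0 ≤ a) (hb : 0 ≤ b) (hc : 0 ≤ c) :
    arctan4 a b c = arctan4 b a c := by
  simp only [arctan4_eq_integral_quarticErf, *, mul_left_comm (quarticErf (a * _))]

lemma arctan4_right_comm {a b c : ℝ} (ha : 0 ≤ a) (hb : 0 ≤ b) (hc : 0 ≤ c) :
    arctan4 a b c = arctan4 a c b := by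
  simp only [arctan4_eq_integral_quarticErf, *, mul_comm (quarticErf (b * _))]

lemma arctan4_div_eq_integral {p q r s : ℝ} (hp : 0 < p) (hq : 0 < q) (hr : 0 < r) (hs : 0 < s) :
    arctan4 (q / p) (r / p) (s / p) = 4 * ∫ t in Ioi (0:ℝ), p * Real.exp (-(p * t) ^ 4) *
      (quarticErf (q * t) * (quarticErf (r * t) * quarticErf (s * t))) := by
  rw [arctan4_eq_integral_quarticErf (by positivity) (by positivity) (by positivity)]
  congr 1
  have h := integral_comp_mul_left_Ioi' (fun t => Real.exp (-t ^ 4) * (quarticErf (q / p * t) *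
    (quarticErf (r / p * t) * quarticErf (s / p * t)))) 0 hp
  rw [mul_zero] at h
  rw [← h, smul_eq_mul, ← integral_const_mul]
  refine integral_congr_ae (Eventually.of_forall fun t => ?_)
  have e (x : ℝ) : x / p * (p * t) = x * t := by field_simp
  simp only [e, mul_assoc]

lemma integrableOn_exp_mul_quarticErf {p q r s : ℝ} (hp : 0 < p) (hq : 0 < q) (hr : 0 < r)
    (hs : 0 < s) : IntegrableOn (fun t => p * Real.exp (-(p * t) ^ 4) *
      (quarticErf (q * t) * (quarticErf (r * t) * quarticErf (s * t)))) (Ioi 0) := by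
  have hint : IntegrableOn (fun t => p * Real.exp (-(p * t) ^ 4)) (Ioi 0) := by
    refine Integrable.const_mul ?_ p
    have := (integrableOn_Ioi_comp_mul_left_iff (fun x : ℝ => Real.exp (-x ^ 4)) 0 hp).2
    rw [mul_zero] at this
    exact this integrableOn_exp_neg_pow_four
  have hc := continuous_quarticErf
  refine Integrable.mul_bdd (c := (1 / 4 * Real.Gamma (1 / 4)) * ((1 / 4 * Real.Gamma (1 / 4)) *
    (1 / 4 * Real.Gamma (1 / 4)))) hint (Continuous.aestronglyMeasurable (by fun_prop)) ?_
  filter_upwards [ae_restrict_mem measurableSet_Ioi] with t ht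
  have ht : 0 < t := ht
  have hn {x : ℝ} (hx : 0 < x) : ‖quarticErf (x * t)‖ ≤ 1 / 4 * Real.Gamma (1 / 4) := by
    rw [Real.norm_of_nonneg (quarticErf_nonneg (by positivity))]
    exact quarticErf_le _
  have hG : 0 ≤ 1 / 4 * Real.Gamma (1 / 4) := (norm_nonneg _).trans (hn one_pos)
  rw [norm_mul, norm_mul]
  gcongr <;> exact hn ‹_›

/-- The four cones on which a given weighted coordinate is the largest fill out the positive
orthant of `ℝ⁴`. -/
lemma sum_arctan4_div {p q r s : ℝ} (hp : 0 < p) (hq : 0 < q) (hr : 0 < r) (hs : 0 < s) :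
    arctan4 (q / p) (r / p) (s / p) + arctan4 (p / q) (r / q) (s / q) +
      arctan4 (p / r) (q / r) (s / r) + arctan4 (p / s) (q / s) (r / s) =
      4 * ((1 / 4) * Real.Gamma (1 / 4)) ^ 4 := by
  have hd {x : ℝ} (t : ℝ) :
      HasDerivAt (fun t => quarticErf (x * t)) (x * Real.exp (-(x * t) ^ 4)) t := by
    have h := (hasDerivAt_quarticErf (x * t)).comp t ((hasDerivAt_id t).const_mul x)
    exact h.congr_deriv (by ring)
  have hlim {x : ℝ} (hx : 0 < x) :
      Tendsto (fun t => quarticErf (x * t)) atTop (𝓝 (1 / 4 * Real.Gamma (1 / 4))) :=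
    tendsto_quarticErf_atTop.comp (tendsto_id.const_mul_atTop hx)
  let K : ℝ → ℝ → ℝ → ℝ → ℝ → ℝ := fun p q r s t => p * Real.exp (-(p * t) ^ 4) *
    (quarticErf (q * t) * (quarticErf (r * t) * quarticErf (s * t)))
  have ip : IntegrableOn (K p q r s) (Ioi 0) := integrableOn_exp_mul_quarticErf hp hq hr hs
  have iq : IntegrableOn (K q p r s) (Ioi 0) := integrableOn_exp_mul_quarticErf hq hp hr hs
  have ir : IntegrableOn (K r p q s) (Ioi 0) := integrableOn_exp_mul_quarticErf hr hp hq hs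
  have is : IntegrableOn (K s p q r) (Ioi 0) := integrableOn_exp_mul_quarticErf hs hp hq hr
  have key := integral_Ioi_of_hasDerivAt_of_tendsto'
    (f := fun t => quarticErf (p * t) * quarticErf (q * t) * quarticErf (r * t) *
      quarticErf (s * t)) (fun t _ => ((((hd t).mul (hd t)).mul (hd t)).mul (hd t)).congr_deriv
        (show _ = (K p q r s + K q p r s + K r p q s + K s p q r) t by
          simp only [K, Pi.mul_apply, Pi.add_apply]
          ring)) (((ip.add iq).add ir).add is)
    ((((hlim hp).mul (hlim hq)).mul (hlim hr)).mul (hlim hs))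
  rw [integral_add' ((ip.add iq).add ir) is, integral_add' (ip.add iq) ir,
    integral_add' ip iq] at key
  simp only [mul_zero, quarticErf_zero, sub_zero] at key
  rw [arctan4_div_eq_integral hp hq hr hs, arctan4_div_eq_integral hq hp hr hs,
    arctan4_div_eq_integral hr hp hq hs, arctan4_div_eq_integral hs hp hq hr,
    ← mul_add, ← mul_add, ← mul_add]
  exact congrArg (4 * ·) (key.trans (by ring))

/-- For `u, v > 0`,
`Φ(u,v) + Φ(1/u,1/v) = 4 · ((1/4)·Γ(1/4))⁴`. -/
theorem Phi_add_Phi_inv (u v : ℝ) (hu : 0 < u) (hv : 0 < v) :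
    Phi u v + Phi (1 / u) (1 / v) = 4 * ((1 / 4) * Real.Gamma (1 / 4)) ^ 4 := by
  rw [← sum_arctan4_div one_pos hu hv (div_pos hu hv), Phi, Phi,
    arctan4_comm (a := u / v) (by positivity) (by positivity) (by positivity),
    arctan4_right_comm (a := 1 / u) (by positivity) (by positivity) (by positivity), ← add_assoc,
    add_right_comm (arctan4 u v (u / v))]
  congr 1
  · congr 1
    · congr 1
      · simp only [div_one]
      · congr 1 <;> field_simp
    · congr 1; field_simp
  · congr 1 <;> field_simp
end

section
/- For all real numbers u > 0 and v > 0, 3uv · (∫₀^{+∞} e^{-x³} dx) · (∫₀^{+∞} e^{-(ux)³} dx) · (∫₀^{+∞} e^{-(vx)³} dx) = ∫₀^u ∫₀^v 1/(1 + t³ + s³) dt ds + ∫₀^{1/u} ∫₀^{v/u} 1/(1 + t³ + s³) dt ds + ∫₀^{1/v} ∫₀^{u/v} 1/(1 + t³ + s³) dt ds. -/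
open MeasureTheory

/-- A primitive of `exp (-x³)`. -/
noncomputable def expNegCubePrimitive (a : ℝ) : ℝ := ∫ x in (0 : ℝ)..a, Real.exp (-x ^ 3)

lemma integrableOn_exp_neg_cube :
    IntegrableOn (fun x : ℝ => Real.exp (-x ^ 3)) (Set.Ioi 0) := by
  refine (integrableOn_rpow_mul_exp_neg_rpow (p := 3) (s := 0) (by norm_num)
    (by norm_num)).congr_fun (fun x _ => ?_) measurableSet_Ioi
  simp only [Real.rpow_zero, one_mul]
  norm_cast

lemma hasDerivAt_expNegCubePrimitive (a : ℝ) :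
    HasDerivAt expNegCubePrimitive (Real.exp (-a ^ 3)) a := by
  have hc : Continuous fun x : ℝ => Real.exp (-x ^ 3) := by fun_prop
  exact hc.integral_hasStrictDerivAt 0 a |>.hasDerivAt

lemma tendsto_expNegCubePrimitive :
    Filter.Tendsto expNegCubePrimitive Filter.atTop
      (nhds (∫ x in Set.Ioi (0 : ℝ), Real.exp (-x ^ 3))) :=
  intervalIntegral_tendsto_integral_Ioi 0 integrableOn_exp_neg_cube Filter.tendsto_id

lemma expNegCubePrimitive_mul {a : ℝ} (ha : 0 ≤ a) (x : ℝ) :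
    expNegCubePrimitive (a * x) = x * ∫ t in Set.Icc 0 a, Real.exp (-(x * t) ^ 3) := by
  rw [integral_Icc_eq_integral_Ioc, ← intervalIntegral.integral_of_le ha,
    intervalIntegral.mul_integral_comp_mul_left (f := fun y => Real.exp (-y ^ 3)),
    mul_zero, mul_comm x a]
  rfl

lemma hasDerivAt_neg_exp_neg_mul_cube {c : ℝ} (hc : 0 < c) (x : ℝ) :
    HasDerivAt (fun x : ℝ => -Real.exp (-(c * x ^ 3)) / (3 * c))
      (x ^ 2 * Real.exp (-(c * x ^ 3))) x := by
  have h := ((((hasDerivAt_pow 3 x).const_mul c).neg.exp).neg).div_const (3 * c)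
  refine h.congr_deriv ?_
  field_simp
  norm_num
  ring

lemma tendsto_neg_exp_neg_mul_cube {c : ℝ} (hc : 0 < c) :
    Filter.Tendsto (fun x : ℝ => -Real.exp (-(c * x ^ 3)) / (3 * c)) Filter.atTop (nhds 0) := by
  have h : Filter.Tendsto (fun x : ℝ => c * x ^ 3) Filter.atTop Filter.atTop :=
    (Filter.tendsto_pow_atTop (by norm_num)).const_mul_atTop hc
  simpa using ((Real.tendsto_exp_neg_atTop_nhds_zero.comp h).neg).div_const (3 * c)

lemma integrableOn_sq_mul_exp_neg_mul_cube {c : ℝ} (hc : 0 < c) :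
    IntegrableOn (fun x : ℝ => x ^ 2 * Real.exp (-(c * x ^ 3))) (Set.Ioi 0) :=
  integrableOn_Ioi_deriv_of_nonneg' (fun x _ => hasDerivAt_neg_exp_neg_mul_cube hc x)
    (fun x _ => by positivity) (tendsto_neg_exp_neg_mul_cube hc)

lemma integral_sq_mul_exp_neg_mul_cube {c : ℝ} (hc : 0 < c) :
    ∫ x in Set.Ioi (0 : ℝ), x ^ 2 * Real.exp (-(c * x ^ 3)) = 1 / 3 * (1 / c) := by
  rw [integral_Ioi_of_hasDerivAt_of_tendsto' (fun x _ => hasDerivAt_neg_exp_neg_mul_cube hc x)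
    (integrableOn_sq_mul_exp_neg_mul_cube hc) (tendsto_neg_exp_neg_mul_cube hc)]
  simp
  field_simp

lemma integrable_sq_mul_exp_neg_cube_prod (a b : ℝ) :
    Integrable (fun z : ℝ × (ℝ × ℝ) =>
        z.1 ^ 2 * Real.exp (-((1 + z.2.1 ^ 3 + z.2.2 ^ 3) * z.1 ^ 3)))
      ((volume.restrict (Set.Ioi (0 : ℝ))).prod
        (volume.restrict (Set.Icc (0 : ℝ) a ×ˢ Set.Icc (0 : ℝ) b))) := by
  have : IsFiniteMeasure (volume.restrict (Set.Icc (0 : ℝ) a ×ˢ Set.Icc (0 : ℝ) b)) :=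
    ⟨by
      rw [Measure.restrict_apply_univ]
      exact (isCompact_Icc.prod isCompact_Icc).measure_lt_top⟩
  refine Integrable.mono'
    ((integrableOn_sq_mul_exp_neg_mul_cube one_pos).comp_fst _) ?_ ?_
  · exact Continuous.aestronglyMeasurable (by fun_prop)
  · rw [Measure.prod_restrict]
    refine (ae_restrict_iff' (measurableSet_Ioi.prod
      (measurableSet_Icc.prod measurableSet_Icc))).2 (Filter.Eventually.of_forall ?_)
    rintro ⟨x, t, s⟩ ⟨hx, ht, hs⟩
    have hx' : 0 < x := hx
    have ht' : 0 ≤ t := ht.1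
    have hs' : 0 ≤ s := hs.1
    rw [Real.norm_of_nonneg (by positivity)]
    dsimp only
    gcongr
    linarith [pow_nonneg ht' 3, pow_nonneg hs' 3]

lemma integral_rect_sq_mul_exp_neg_cube {a b : ℝ} (ha : 0 ≤ a) (hb : 0 ≤ b) (x : ℝ) :
    ∫ p in Set.Icc (0 : ℝ) a ×ˢ Set.Icc (0 : ℝ) b,
        x ^ 2 * Real.exp (-((1 + p.1 ^ 3 + p.2 ^ 3) * x ^ 3))
      = Real.exp (-x ^ 3) * expNegCubePrimitive (a * x) * expNegCubePrimitive (b * x) := by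
  have h (p : ℝ × ℝ) : x ^ 2 * Real.exp (-((1 + p.1 ^ 3 + p.2 ^ 3) * x ^ 3))
      = (x ^ 2 * Real.exp (-x ^ 3)) *
        (Real.exp (-(x * p.1) ^ 3) * Real.exp (-(x * p.2) ^ 3)) := by
    rw [mul_assoc, ← Real.exp_add, ← Real.exp_add]
    ring_nf
  simp_rw [h]
  rw [integral_const_mul, Measure.volume_eq_prod,
    setIntegral_prod_mul (fun t => Real.exp (-(x * t) ^ 3)) (fun s => Real.exp (-(x * s) ^ 3)),
    expNegCubePrimitive_mul ha, expNegCubePrimitive_mul hb]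
  ring

lemma integrableOn_exp_neg_cube_mul_primitives {a b : ℝ} (ha : 0 ≤ a) (hb : 0 ≤ b) :
    IntegrableOn (fun x => Real.exp (-x ^ 3) * expNegCubePrimitive (a * x) *
      expNegCubePrimitive (b * x)) (Set.Ioi 0) := by
  have h := (integrable_sq_mul_exp_neg_cube_prod a b).integral_prod_left
  simp only [integral_rect_sq_mul_exp_neg_cube ha hb] at h
  exact h

lemma integral_exp_neg_cube_mul_primitives {a b : ℝ} (ha : 0 ≤ a) (hb : 0 ≤ b) :
    ∫ x in Set.Ioi (0 : ℝ), Real.exp (-x ^ 3) * expNegCubePrimitive (a * x) *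
        expNegCubePrimitive (b * x)
      = 1 / 3 * ∫ p in Set.Icc (0 : ℝ) a ×ˢ Set.Icc (0 : ℝ) b,
          1 / (1 + p.1 ^ 3 + p.2 ^ 3) := by
  simp_rw [← integral_rect_sq_mul_exp_neg_cube ha hb]
  rw [integral_integral_swap (integrable_sq_mul_exp_neg_cube_prod a b), ← integral_const_mul]
  refine setIntegral_congr_fun (measurableSet_Icc.prod measurableSet_Icc) ?_
  rintro ⟨t, s⟩ ⟨ht, hs⟩
  have ht' : 0 ≤ t := ht.1
  have hs' : 0 ≤ s := hs.1
  exact integral_sq_mul_exp_neg_mul_cube (by positivity)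

lemma integral_Ici_exp_neg_mul_cube {a : ℝ} (ha : 0 < a) :
    ∫ x in Set.Ici (0 : ℝ), Real.exp (-(a * x) ^ 3)
      = a⁻¹ * ∫ x in Set.Ioi (0 : ℝ), Real.exp (-x ^ 3) := by
  rw [integral_Ici_eq_integral_Ioi,
    integral_comp_mul_left_Ioi (fun x => Real.exp (-x ^ 3)) 0 ha, mul_zero, smul_eq_mul]

lemma cube_integral_exp_neg_cube {u v : ℝ} (hu : 0 < u) (hv : 0 < v) :
    (∫ x in Set.Ioi (0 : ℝ), Real.exp (-x ^ 3)) ^ 3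
      = (∫ x in Set.Ioi (0 : ℝ), Real.exp (-x ^ 3) * expNegCubePrimitive (u * x) *
          expNegCubePrimitive (v * x))
        + (∫ x in Set.Ioi (0 : ℝ), Real.exp (-x ^ 3) * expNegCubePrimitive (1 / u * x) *
          expNegCubePrimitive (v / u * x))
        + (∫ x in Set.Ioi (0 : ℝ), Real.exp (-x ^ 3) * expNegCubePrimitive (1 / v * x) *
          expNegCubePrimitive (u / v * x)) := by
  set G : ℝ → ℝ → ℝ → ℝ := fun a b x => Real.exp (-x ^ 3) * expNegCubePrimitive (a * x) *
    expNegCubePrimitive (b * x) with hG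
  have hint {w a b : ℝ} (hw : 0 < w) (ha : 0 ≤ a) (hb : 0 ≤ b) :
      IntegrableOn (fun x => w * G a b (w * x)) (Set.Ioi 0) := by
    refine Integrable.const_mul ?_ w
    refine (integrableOn_Ioi_comp_mul_left_iff (G a b) 0 hw).2 ?_
    rw [mul_zero]
    exact integrableOn_exp_neg_cube_mul_primitives ha hb
  have hval {w : ℝ} (hw : 0 < w) (a b : ℝ) :
      ∫ x in Set.Ioi (0 : ℝ), w * G a b (w * x) = ∫ x in Set.Ioi (0 : ℝ), G a b x := by
    rw [integral_const_mul, integral_comp_mul_left_Ioi (G a b) 0 hw, mul_zero, smul_eq_mul,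
      mul_inv_cancel_left₀ hw.ne']
  have h₁ : IntegrableOn (G u v) (Set.Ioi 0) :=
    integrableOn_exp_neg_cube_mul_primitives hu.le hv.le
  have h₂ := hint hu (a := 1 / u) (b := v / u) (by positivity) (by positivity)
  have h₃ := hint hv (a := 1 / v) (b := u / v) (by positivity) (by positivity)
  have hscale {w : ℝ} (x : ℝ) :
      HasDerivAt (fun x => expNegCubePrimitive (w * x)) (w * Real.exp (-(w * x) ^ 3)) x := by
    have h := (hasDerivAt_expNegCubePrimitive (w * x)).comp x (hasDerivAt_const_mul w)
    rwa [mul_comm] at h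
  have hderiv (x : ℝ) : HasDerivAt
      (fun x => expNegCubePrimitive x * expNegCubePrimitive (u * x) * expNegCubePrimitive (v * x))
      (G u v x + u * G (1 / u) (v / u) (u * x) + v * G (1 / v) (u / v) (v * x)) x := by
    refine (((hasDerivAt_expNegCubePrimitive x).mul (hscale x)).mul (hscale x)).congr_deriv ?_
    have e₁ : 1 / u * (u * x) = x := by field_simp
    have e₂ : v / u * (u * x) = v * x := by field_simp
    have e₃ : 1 / v * (v * x) = x := by field_simp
    have e₄ : u / v * (v * x) = u * x := by field_simp
    simp only [hG, e₁, e₂, e₃, e₄, Pi.mul_apply]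
    ring
  have htend {w : ℝ} (hw : 0 < w) := tendsto_expNegCubePrimitive.comp
    (Filter.tendsto_id.const_mul_atTop hw)
  have key := integral_Ioi_of_hasDerivAt_of_tendsto' (a := (0 : ℝ)) (fun x _ => hderiv x)
    ((h₁.add h₂).add h₃)
    ((tendsto_expNegCubePrimitive.mul (htend hu)).mul (htend hv))
  have hzero : expNegCubePrimitive 0 = 0 := intervalIntegral.integral_same
  have hsplit := integral_add (h₁.add h₂) h₃
  simp only [Pi.add_apply] at hsplit
  rw [hsplit, integral_add h₁ h₂, hval hu, hval hv] at key
  simp only [hzero, zero_mul, sub_zero] at key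
  rw [key]
  ring

/-- For `u, v > 0`,
`3uv · (∫₀^∞ e^{-x³}) · (∫₀^∞ e^{-(ux)³}) · (∫₀^∞ e^{-(vx)³})` equals the sum of the
three double integrals
`∫₀^u∫₀^v 1/(1+t³+s³) + ∫₀^{1/u}∫₀^{v/u} 1/(1+t³+s³) + ∫₀^{1/v}∫₀^{u/v} 1/(1+t³+s³)`. -/
theorem product_of_exp_integrals_eq_sum_of_arctan3 (u v : ℝ) (hu : 0 < u) (hv : 0 < v) :
    3 * u * v * (∫ x in Set.Ici (0:ℝ), Real.exp (-x ^ 3))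
        * (∫ x in Set.Ici (0:ℝ), Real.exp (-(u * x) ^ 3))
        * (∫ x in Set.Ici (0:ℝ), Real.exp (-(v * x) ^ 3))
      = (∫ p in Set.Icc (0:ℝ) u ×ˢ Set.Icc (0:ℝ) v, 1 / (1 + p.1 ^ 3 + p.2 ^ 3))
        + (∫ p in Set.Icc (0:ℝ) (1 / u) ×ˢ Set.Icc (0:ℝ) (v / u),
            1 / (1 + p.1 ^ 3 + p.2 ^ 3))
        + (∫ p in Set.Icc (0:ℝ) (1 / v) ×ˢ Set.Icc (0:ℝ) (u / v),
            1 / (1 + p.1 ^ 3 + p.2 ^ 3)) := by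
  have hI : ∫ x in Set.Ici (0 : ℝ), Real.exp (-x ^ 3) = ∫ x in Set.Ioi (0 : ℝ), Real.exp (-x ^ 3) :=
    integral_Ici_eq_integral_Ioi
  have key := cube_integral_exp_neg_cube hu hv
  rw [integral_exp_neg_cube_mul_primitives hu.le hv.le,
    integral_exp_neg_cube_mul_primitives (by positivity) (by positivity),
    integral_exp_neg_cube_mul_primitives (by positivity) (by positivity)] at key
  rw [hI, integral_Ici_exp_neg_mul_cube hu, integral_Ici_exp_neg_mul_cube hv]
  set I := ∫ x in Set.Ioi (0 : ℝ), Real.exp (-x ^ 3)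
  have hL : 3 * u * v * I * (u⁻¹ * I) * (v⁻¹ * I) = 3 * I ^ 3 := by
    field_simp
  rw [hL, key]
  ring
end
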